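/- arXiv:2110.12452 — 3 statements merged into one kernel-verified Lean document; each statement's English description precedes it below -/
import Mathlib

section
/- Fix k ≥ 1 and consider the protocol Π_k defined in the context. For every n ∈ ℤ⁺ with n ≥ 2^{k+1} − 1 and every configuration C reachable from I_n, there is a configuration reachable from C that contains an agent in the state F. -/
/-- A population protocol `⟨Q, Q₀, Q₁, q_init, δ⟩` over a set of states `Q`. -/
structure PopulationProtocol (Q : Type) where
  Q0 : Set Q
  Q1 : Set Q
  qinit : Q
  delta : Q → Q → Set (Q × Q)
  union_eq : Q0 ∪ Q1 = Set.univ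
  inter_eq : Q0 ∩ Q1 = ∅
  delta_nonempty : ∀ q1 q2 : Q, (delta q1 q2).Nonempty

namespace PopulationProtocol

variable {Q : Type} (P : PopulationProtocol Q)

/-- A protocol is deterministic if every value of `δ` is a singleton. -/
def Deterministic : Prop := ∀ q1 q2 : Q, ∃ p : Q × Q, P.delta q1 q2 = {p}

/-- The initial `n`-size configuration `I_n`: all agents in the initial state. -/
def initConfig (n : ℕ) : Fin n → Q := fun _ => P.qinit

/-- `(C1, C2)` is a transition: two distinct agents interact according to `δ`,
all other agents keep their state. -/
def Transition {n : ℕ} (C1 C2 : Fin n → Q) : Prop :=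
  ∃ i j : Fin n, i ≠ j ∧ (C2 i, C2 j) ∈ P.delta (C1 i) (C1 j) ∧
    ∀ k : Fin n, k ≠ i → k ≠ j → C2 k = C1 k

/-- `D` is reachable from `C` via a finite sequence of transitions. -/
def Reachable {n : ℕ} (C D : Fin n → Q) : Prop :=
  Relation.ReflTransGen P.Transition C D

/-- An execution: an infinite sequence of configurations starting from `I_n`,
each consecutive pair being a transition. -/
def IsExecution {n : ℕ} (E : ℕ → Fin n → Q) : Prop :=
  E 0 = P.initConfig n ∧ ∀ i : ℕ, P.Transition (E i) (E (i + 1))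

/-- Fairness: whenever `C` occurs infinitely often and `D` is reachable from `C`,
`D` also occurs infinitely often. -/
def Fair {n : ℕ} (E : ℕ → Fin n → Q) : Prop :=
  ∀ C D : Fin n → Q, (∀ N : ℕ, ∃ i ≥ N, E i = C) → P.Reachable C D →
    (∀ N : ℕ, ∃ i ≥ N, E i = D)

/-- `Π` is a 1-aware population protocol computing the predicate `R`. -/
def Computes1Aware (R : ℕ → Bool) : Prop :=
  ∀ n : ℕ, 0 < n →
    (R n = false →
      ∀ C : Fin n → Q, P.Reachable (P.initConfig n) C → ∀ i : Fin n, C i ∈ P.Q0) ∧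
    (R n = true →
      ∀ E : ℕ → Fin n → Q, P.IsExecution E → P.Fair E →
        ∃ i0 : ℕ, ∀ i ≥ i0, ∀ a : Fin n, E i a ∈ P.Q1)

/-- A state `q` can occur from a configuration `C`. -/
def CanOccur {n : ℕ} (C : Fin n → Q) (q : Q) : Prop :=
  ∃ D : Fin n → Q, P.Reachable C D ∧ ∃ i : Fin n, D i = q

/-- `f q`: the minimal `n ∈ ℤ⁺` such that `q` can occur from `I_n`
(`⊤` if there is no such `n`). -/
noncomputable def f (q : Q) : ℕ∞ :=
  sInf {m : ℕ∞ | ∃ n : ℕ, m = (n : ℕ∞) ∧ 0 < n ∧ P.CanOccur (P.initConfig n) q}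

/-- `f(Q)`: the set of finite values of `f`. -/
def fQ : Set ℕ := {n : ℕ | ∃ q : Q, P.f q = (n : ℕ∞)}

end PopulationProtocol

/-- The threshold predicate `R_d(n) = 1 ↔ n ≥ d`. -/
def threshold (d : ℕ) : ℕ → Bool := fun n => decide (d ≤ n)

/-- `e(m)`: the number of `1`s in the binary representation of `m`. -/
def onesCount (m : ℕ) : ℕ := (Nat.digits 2 m).count 1

/-- `z(m)`: the number of `0`s in the binary representation of `m`
(no leading zeros). -/
def zerosCount (m : ℕ) : ℕ := (Nat.digits 2 m).count 0

/-- States of the protocol `Π_k`: bankrupt `B`, final `F`, and `c i` ("holding `2^i` coins"). -/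
inductive PkState (k : ℕ) where
  | B : PkState k
  | F : PkState k
  | c : Fin (k + 1) → PkState k
  deriving DecidableEq

/-- The transition function of `Π_k`. -/
def PkDelta (k : ℕ) : PkState k → PkState k → Set (PkState k × PkState k)
  | .F, _ => {(.F, .F)}
  | _, .F => {(.F, .F)}
  | .c i, .c j =>
      if i = j then
        if h : i.val = k then {(.F, .F)}
        else if i.val = k - 1 then
          {(.c ⟨i.val + 1, by have := i.isLt; omega⟩, .c ⟨0, by omega⟩)}
        else {(.c ⟨i.val + 1, by have := i.isLt; omega⟩, .B)}
      else {(.c i, .c j)}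
  | q, q' => {(q, q')}

/-- The protocol `Π_k` (warm-up protocol for `d = 2^{k+1} - 1`). -/
def PiK (k : ℕ) : PopulationProtocol (PkState k) where
  Q0 := {q | q ≠ .F}
  Q1 := {.F}
  qinit := .c ⟨0, by omega⟩
  delta := PkDelta k
  union_eq := by
    ext q; simp [Set.mem_union]; tauto
  inter_eq := by
    ext q; simp
  delta_nonempty := by
    intro q1 q2
    cases q1 <;> cases q2 <;> simp only [PkDelta] <;>
      first
      | (split_ifs <;> exact Set.singleton_nonempty _)
      | exact Set.singleton_nonempty _

def PkW (k : ℕ) : PkState k → ℕ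
  | .B => 0
  | .F => 0
  | .c i => if i.val = k then 2 ^ k - 1 else 2 ^ i.val

def PkM (k : ℕ) : PkState k → ℕ
  | .B => 1
  | .F => 0
  | .c i => if i.val = k then 1 else 0

theorem Pk_delta_spec (k : ℕ) (hk : 1 ≤ k) (q1 q2 : PkState k) (p : PkState k × PkState k)
    (hp : p ∈ PkDelta k q1 q2) :
    p.1 = .F ∨ PkW k p.1 + PkW k p.2 = PkW k q1 + PkW k q2 := by
  obtain ⟨p1, p2⟩ := p
  rcases q1 with _ | _ | a <;> rcases q2 with _ | _ | b <;> simp only [PkDelta] at hp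
  case c.c =>
    split_ifs at hp with h1 h2 h3
    · simp at hp; simp [hp]
    · right
      simp only [Set.mem_singleton_iff, Prod.mk.injEq] at hp
      obtain ⟨rfl, rfl⟩ := hp
      subst h1
      obtain ⟨m, rfl⟩ : ∃ m, k = m + 1 := ⟨k - 1, by omega⟩
      have : 0 < 2 ^ m := by positivity
      simp [PkW, h3, pow_succ]
      omega
    · right
      simp only [Set.mem_singleton_iff, Prod.mk.injEq] at hp
      obtain ⟨rfl, rfl⟩ := hp
      subst h1
      have h4 : ¬ a.val + 1 = k := by omega
      simp [PkW, h2, h4, pow_succ]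
      omega
    · right
      simp at hp; simp [hp]
  all_goals (simp at hp; simp [hp])

theorem Pk_delta_prog (k : ℕ) (hk : 1 ≤ k) (a : Fin (k + 1)) :
    ∃ p ∈ PkDelta k (.c a) (.c a),
      p.1 = .F ∨ PkM k (.c a) + PkM k (.c a) < PkM k p.1 + PkM k p.2 := by
  simp only [PkDelta, if_true]
  split_ifs with h2 h3
  · exact ⟨_, rfl, Or.inl rfl⟩
  · refine ⟨_, rfl, Or.inr ?_⟩
    have h4 : a.val + 1 = k := by omega
    simp [PkM, h2, h4]
  · refine ⟨_, rfl, Or.inr ?_⟩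
    have h4 : ¬ a.val + 1 = k := by omega
    simp [PkM, h2, h4]

theorem Pk_sum_two {Q : Type} {n : ℕ} (f : Q → ℕ) (C1 C2 : Fin n → Q) (i j : Fin n) (hij : i ≠ j)
    (h : ∀ k : Fin n, k ≠ i → k ≠ j → C2 k = C1 k) :
    ∑ x, f (C2 x) + (f (C1 i) + f (C1 j)) = ∑ x, f (C1 x) + (f (C2 i) + f (C2 j)) := by
  have key : ∀ C : Fin n → Q, ∑ x, f (C x) =
      f (C i) + (f (C j) + ∑ x ∈ (Finset.univ.erase i).erase j, f (C x)) := by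
    intro C
    rw [Finset.add_sum_erase _ (fun x => f (C x)) (by simp [hij.symm]),
      Finset.add_sum_erase _ (fun x => f (C x)) (by simp)]
  have : ∑ x ∈ (Finset.univ.erase i).erase j, f (C2 x)
      = ∑ x ∈ (Finset.univ.erase i).erase j, f (C1 x) := by
    apply Finset.sum_congr rfl
    intro x hx
    simp at hx
    rw [h x hx.2 hx.1]
  rw [key C1, key C2, this]
  omega

theorem Pk_inv_step (k : ℕ) (hk : 1 ≤ k) {n : ℕ} (C1 C2 : Fin n → PkState k)
    (ht : (PiK k).Transition C1 C2)
    (h : (∃ i, C1 i = .F) ∨ ∑ x, PkW k (C1 x) = n) :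
    (∃ i, C2 i = .F) ∨ ∑ x, PkW k (C2 x) = n := by
  obtain ⟨i, j, hij, hd, hr⟩ := ht
  change _ ∈ PkDelta k _ _ at hd
  rcases h with ⟨l, hl⟩ | h
  · left
    by_cases h1 : l = i
    · subst h1
      rw [hl] at hd
      simp [PkDelta] at hd
      exact ⟨_, hd.1⟩
    · by_cases h2 : l = j
      · subst h2
        rw [hl] at hd
        refine ⟨i, ?_⟩
        cases hq : C1 i <;> rw [hq] at hd <;> simp [PkDelta] at hd <;> exact hd.1
      · exact ⟨l, by rw [hr l h1 h2, hl]⟩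
  · rcases Pk_delta_spec k hk _ _ _ hd with h1 | h1
    · exact Or.inl ⟨i, h1⟩
    · right
      have := Pk_sum_two (PkW k) C1 C2 i j hij hr
      simp only at h1
      omega

theorem Pk_sumW (k : ℕ) (hk : 1 ≤ k) : ∑ a : Fin (k + 1), PkW k (.c a) + 2 = 2 ^ (k + 1) := by
  rw [Fin.sum_univ_castSucc]
  have : ∀ a : Fin k, PkW k (.c a.castSucc) = 2 ^ a.val := by
    intro a
    have := a.isLt
    simp [PkW, this.ne]
  simp only [this]
  rw [Fin.sum_univ_eq_sum_range (fun x => 2 ^ x) k]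
  have h2 := Nat.geomSum_eq (le_refl 2) k
  have : 0 < 2 ^ k := by positivity
  simp [PkW, h2, pow_succ]
  omega

theorem Pk_terminal (k : ℕ) (hk : 1 ≤ k) {n : ℕ} (C : Fin n → PkState k)
    (h : ∀ i j a, C i = .c a → C j = .c a → i = j) :
    ∑ x, PkW k (C x) + 2 ≤ 2 ^ (k + 1) := by
  rw [← Pk_sumW k hk]
  have h1 : ∀ x, PkW k (C x) = ∑ a : Fin (k + 1), if C x = .c a then PkW k (.c a) else 0 := by
    intro x
    cases hx : C x with
    | B => simp [PkW]
    | F => simp [PkW]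
    | c b => simp
  simp only [h1]
  rw [Finset.sum_comm]
  gcongr with a
  by_cases ha : ∃ i, C i = .c a
  · obtain ⟨i, hi⟩ := ha
    rw [Finset.sum_eq_single i]
    · simp [hi]
    · intro j _ hj
      rw [if_neg]
      intro hc
      exact hj (h j i a hc hi)
    · simp
  · push Not at ha
    simp [ha]

theorem Pk_progress (k : ℕ) (hk : 1 ≤ k) (n : ℕ) (hn : 2 ^ (k + 1) - 1 ≤ n) (d : ℕ) :
    ∀ C : Fin n → PkState k, n < d + ∑ x, PkM k (C x) →
    ((∃ i, C i = .F) ∨ ∑ x, PkW k (C x) = n) →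
    ∃ D : Fin n → PkState k, (PiK k).Reachable C D ∧ ∃ i : Fin n, D i = PkState.F := by
  induction d with
  | zero =>
    intro C hC h
    exfalso
    have hle : ∀ x, PkM k (C x) ≤ 1 := by
      intro x
      cases C x <;> simp only [PkM]
      · omega
      · omega
      · split_ifs <;> omega
    have h2 : ∑ x, PkM k (C x) ≤ ∑ x : Fin n, 1 := Finset.sum_le_sum fun x _ => hle x
    simp at h2
    omega
  | succ d ih =>
    intro C hC h
    rcases h with h | h
    · exact ⟨C, .refl, h⟩
    by_cases ht : ∀ i j a, C i = .c a → C j = .c a → i = j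
    · have := Pk_terminal k hk C ht
      omega
    push Not at ht
    obtain ⟨i, j, a, hi, hj, hij⟩ := ht
    obtain ⟨p, hp, hp2⟩ := Pk_delta_prog k hk a
    let C2 : Fin n → PkState k := fun x => if x = i then p.1 else if x = j then p.2 else C x
    have e1 : C2 i = p.1 := by simp [C2]
    have e2 : C2 j = p.2 := by simp [C2, hij.symm]
    have e3 : ∀ x : Fin n, x ≠ i → x ≠ j → C2 x = C x := by
      intro x h1 h2
      simp [C2, h1, h2]
    have tr : (PiK k).Transition C C2 := by
      refine ⟨i, j, hij, ?_, e3⟩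
      rw [e1, e2, hi, hj]
      exact hp
    rcases hp2 with hp2 | hp2
    · exact ⟨C2, .single tr, i, by rw [e1, hp2]⟩
    · have hs := Pk_sum_two (PkM k) C C2 i j hij e3
      rw [e1, e2, hi, hj] at hs
      obtain ⟨D, hD, hF⟩ := ih C2 (by omega) (Pk_inv_step k hk C C2 tr (Or.inr h))
      exact ⟨D, .head tr hD, hF⟩

theorem PiK_complete (k : ℕ) (hk : 1 ≤ k) (n : ℕ) (hn : 2 ^ (k + 1) - 1 ≤ n)
    (C : Fin n → PkState k) (h : (PiK k).Reachable ((PiK k).initConfig n) C) :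
    ∃ D : Fin n → PkState k, (PiK k).Reachable C D ∧
      ∃ i : Fin n, D i = PkState.F := by
  have hinv : (∃ i, C i = .F) ∨ ∑ x, PkW k (C x) = n := by
    unfold PopulationProtocol.Reachable at h
    induction h with
    | refl =>
      right
      have : ¬ 0 = k := by omega
      simp [PopulationProtocol.initConfig, PiK, PkW, this]
    | tail _ ht ih => exact Pk_inv_step k hk _ _ ht ih
  exact Pk_progress k hk n hn (n + 1) C (by omega) hinv
end

section
/- For every integer d ≥ 2, the protocol Π^A_d defined in the context is a deterministic 1-aware population protocol computing the threshold predicate R_d, and it has exactly d + 1 states. -/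
/-- The transition function of the protocol `Π^A_d` of Angluin et al.
A state `Sum.inl x` means the agent holds `x` coins; `Sum.inr ()` is the
converted state `⊤`. -/
def ADelta (d : ℕ) :
    (Fin d ⊕ Unit) → (Fin d ⊕ Unit) → Set ((Fin d ⊕ Unit) × (Fin d ⊕ Unit))
  | .inl x, .inl y =>
      if h : x.val + y.val < d then {(.inl ⟨x.val + y.val, h⟩, .inl ⟨0, by omega⟩)}
      else {(.inr (), .inr ())}
  | _, _ => {(.inr (), .inr ())}

/-- The protocol `Π^A_d` of Angluin et al. for the threshold `d ≥ 2`. -/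
def PiA (d : ℕ) (hd : 2 ≤ d) : PopulationProtocol (Fin d ⊕ Unit) where
  Q0 := Set.range Sum.inl
  Q1 := {.inr ()}
  qinit := .inl ⟨1, by omega⟩
  delta := ADelta d
  union_eq := by
    ext q; cases q with
    | inl x => simp
    | inr u => cases u; simp
  inter_eq := by
    ext q; cases q <;> simp
  delta_nonempty := by
    intro q1 q2
    cases q1 <;> cases q2 <;> simp only [ADelta] <;>
      first
      | (split_ifs <;> exact Set.singleton_nonempty _)
      | exact Set.singleton_nonempty _

lemma sum_split {Q : Type} {n : ℕ} (g : Q → ℕ) (C D : Fin n → Q) (i j : Fin n) (hij : i ≠ j)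
    (h : ∀ k : Fin n, k ≠ i → k ≠ j → D k = C k) :
    (∑ k, g (D k)) + (g (C i) + g (C j)) = (∑ k, g (C k)) + (g (D i) + g (D j)) := by
  have hj : j ∈ Finset.univ.erase i := by simp [hij.symm]
  have key : ∀ B : Fin n → Q, ∑ k, g (B k) =
      g (B i) + (g (B j) + ∑ k ∈ (Finset.univ.erase i).erase j, g (B k)) := by
    intro B
    rw [Finset.add_sum_erase _ (fun k => g (B k)) hj,
      Finset.add_sum_erase _ (fun k => g (B k)) (Finset.mem_univ i)]
  have e : ∑ k ∈ (Finset.univ.erase i).erase j, g (D k) =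
      ∑ k ∈ (Finset.univ.erase i).erase j, g (C k) := by
    apply Finset.sum_congr rfl
    intro k hk
    simp only [Finset.mem_erase, Finset.mem_univ, and_true] at hk
    rw [h k hk.2 hk.1]
  rw [key C, key D, e]
  omega

lemma pair_le_sum {Q : Type} {n : ℕ} (g : Q → ℕ) (C : Fin n → Q) (i j : Fin n) (hij : i ≠ j) :
    g (C i) + g (C j) ≤ ∑ k, g (C k) := by
  have := Finset.sum_le_sum_of_subset (f := fun k => g (C k)) (Finset.subset_univ {i, j})
  rwa [Finset.sum_pair hij] at this

def coins (d : ℕ) : Fin d ⊕ Unit → ℕ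
  | .inl x => x.val
  | .inr _ => 0

def pot (d : ℕ) : Fin d ⊕ Unit → ℕ
  | .inl x => if x.val = 0 then 1 else 2
  | .inr _ => 0

def AInv (d n : ℕ) (C : Fin n → Fin d ⊕ Unit) : Prop :=
  (d ≤ n ∧ ∃ a, C a = .inr ()) ∨ ((∀ a, ∃ x, C a = .inl x) ∧ ∑ a, coins d (C a) = n)

lemma ADelta_top_left (d : ℕ) (q : Fin d ⊕ Unit) (u : Unit) :
    ADelta d (.inr u) q = {(.inr (), .inr ())} := by
  cases q <;> rfl

lemma ADelta_top_right (d : ℕ) (q : Fin d ⊕ Unit) (u : Unit) :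
    ADelta d q (.inr u) = {(.inr (), .inr ())} := by
  cases q <;> rfl

lemma AInv_step (d : ℕ) (hd : 2 ≤ d) {n : ℕ} (C D : Fin n → Fin d ⊕ Unit)
    (hC : AInv d n C) (h : (PiA d hd).Transition C D) : AInv d n D := by
  obtain ⟨i, j, hij, hm, hk⟩ := h
  change (D i, D j) ∈ ADelta d (C i) (C j) at hm
  rcases hC with ⟨hn, a, ha⟩ | ⟨hall, hsum⟩
  · left
    refine ⟨hn, ?_⟩
    by_cases hai : a = i
    · subst hai
      rw [ha, ADelta_top_left] at hm
      simp only [Set.mem_singleton_iff, Prod.mk.injEq] at hm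
      exact ⟨a, hm.1⟩
    by_cases haj : a = j
    · subst haj
      rw [ha, ADelta_top_right] at hm
      simp only [Set.mem_singleton_iff, Prod.mk.injEq] at hm
      exact ⟨a, hm.2⟩
    exact ⟨a, (hk a hai haj).trans ha⟩
  · obtain ⟨x, hx⟩ := hall i
    obtain ⟨y, hy⟩ := hall j
    have hs := sum_split (coins d) C D i j hij hk
    have hp := pair_le_sum (coins d) C i j hij
    rw [hx, hy] at hm hs hp
    simp only [ADelta] at hm
    split_ifs at hm with hlt
    · simp only [Set.mem_singleton_iff, Prod.mk.injEq] at hm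
      right
      refine ⟨fun a => ?_, ?_⟩
      · by_cases hai : a = i
        · exact ⟨_, hai ▸ hm.1⟩
        by_cases haj : a = j
        · exact ⟨_, haj ▸ hm.2⟩
        rw [hk a hai haj]
        exact hall a
      · rw [hm.1, hm.2] at hs
        simp only [coins] at hs hsum ⊢
        omega
    · simp only [Set.mem_singleton_iff, Prod.mk.injEq] at hm
      left
      simp only [coins] at hp hsum
      exact ⟨by omega, i, hm.1⟩

lemma AInv_init (d : ℕ) (hd : 2 ≤ d) (n : ℕ) : AInv d n ((PiA d hd).initConfig n) := by
  right
  refine ⟨fun a => ⟨_, rfl⟩, ?_⟩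
  simp [PopulationProtocol.initConfig, PiA, coins]

lemma AInv_reach (d : ℕ) (hd : 2 ≤ d) {n : ℕ} (C D : Fin n → Fin d ⊕ Unit)
    (hC : AInv d n C) (h : (PiA d hd).Reachable C D) : AInv d n D := by
  induction h with
  | refl => exact hC
  | tail _ h2 ih => exact AInv_step d hd _ _ ih h2

lemma exists_step (d : ℕ) (hd : 2 ≤ d) {n : ℕ} (C : Fin n → Fin d ⊕ Unit) (i j : Fin n)
    (hij : i ≠ j) (p q : Fin d ⊕ Unit) (h : (p, q) ∈ ADelta d (C i) (C j))
    (hlt : pot d p + pot d q < pot d (C i) + pot d (C j)) :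
    ∃ D, (PiA d hd).Transition C D ∧ ∑ a, pot d (D a) < ∑ a, pot d (C a) := by
  have hi : Function.update (Function.update C i p) j q i = p := by
    simp [Function.update_of_ne hij]
  have hj : Function.update (Function.update C i p) j q j = q := by simp
  have hk : ∀ k, k ≠ i → k ≠ j → Function.update (Function.update C i p) j q k = C k := by
    intro k h1 h2
    simp [Function.update_of_ne h1, Function.update_of_ne h2]
  refine ⟨Function.update (Function.update C i p) j q, ⟨i, j, hij, ?_, hk⟩, ?_⟩
  · rw [hi, hj]; exact h
  · have := sum_split (pot d) C _ i j hij hk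
    rw [hi, hj] at this
    omega

lemma progress (d : ℕ) (hd : 2 ≤ d) {n : ℕ} (hn : d ≤ n) (C : Fin n → Fin d ⊕ Unit)
    (hC : AInv d n C) (hne : C ≠ fun _ => .inr ()) :
    ∃ D, (PiA d hd).Transition C D ∧ ∑ a, pot d (D a) < ∑ a, pot d (C a) := by
  rcases hC with ⟨_, a, ha⟩ | ⟨hall, hsum⟩
  · obtain ⟨b, hb⟩ := Function.ne_iff.mp hne
    have hab : a ≠ b := by
      rintro rfl
      exact hb ha
    refine exists_step d hd C a b hab (.inr ()) (.inr ()) ?_ ?_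
    · rw [ha, ADelta_top_left]; rfl
    · rcases hCb : C b with x | u
      · simp only [pot]
        split_ifs <;> omega
      · exact absurd hCb hb
  · have h1 : ∃ i, coins d (C i) ≠ 0 := by
      by_contra! hcon
      rw [Finset.sum_eq_zero (fun i _ => hcon i)] at hsum
      omega
    obtain ⟨i, hi⟩ := h1
    have h2 : ∃ j, i ≠ j ∧ coins d (C j) ≠ 0 := by
      by_contra! hcon
      rw [Finset.sum_eq_single i (fun j _ hj => hcon j hj.symm) (by simp)] at hsum
      obtain ⟨x, hx⟩ := hall i
      rw [hx] at hsum
      have := x.isLt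
      simp only [coins] at hsum
      omega
    obtain ⟨j, hij, hj⟩ := h2
    obtain ⟨x, hx⟩ := hall i
    obtain ⟨y, hy⟩ := hall j
    rw [hx] at hi
    rw [hy] at hj
    simp only [coins] at hi hj
    by_cases hlt : x.val + y.val < d
    · refine exists_step d hd C i j hij (.inl ⟨x.val + y.val, hlt⟩) (.inl ⟨0, by omega⟩) ?_ ?_
      · rw [hx, hy]; simp [ADelta, hlt]
      · rw [hx, hy]; simp [pot, hi, hj]
    · refine exists_step d hd C i j hij (.inr ()) (.inr ()) ?_ ?_
      · rw [hx, hy]; simp [ADelta, hlt]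
      · rw [hx, hy]; simp [pot, hi, hj]

lemma reach_top (d : ℕ) (hd : 2 ≤ d) {n : ℕ} (hn : d ≤ n) (m : ℕ) :
    ∀ C : Fin n → Fin d ⊕ Unit, ∑ a, pot d (C a) = m → AInv d n C →
      (PiA d hd).Reachable C (fun _ => .inr ()) := by
  induction m using Nat.strong_induction_on with
  | _ m ih =>
    intro C hm hC
    by_cases hne : C = fun _ => .inr ()
    · rw [hne]; exact Relation.ReflTransGen.refl
    · obtain ⟨D, hD, hlt⟩ := progress d hd hn C hC hne
      exact Relation.ReflTransGen.head hD
        (ih _ (hm ▸ hlt) D rfl (AInv_step d hd C D hC hD))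

lemma top_absorb (d : ℕ) (hd : 2 ≤ d) {n : ℕ} (D : Fin n → Fin d ⊕ Unit)
    (h : (PiA d hd).Transition (fun _ => .inr ()) D) : D = fun _ => .inr () := by
  obtain ⟨i, j, hij, hm, hk⟩ := h
  change (D i, D j) ∈ ADelta d (.inr ()) (.inr ()) at hm
  rw [ADelta_top_left] at hm
  simp only [Set.mem_singleton_iff, Prod.mk.injEq] at hm
  funext a
  by_cases hai : a = i
  · rw [hai]; exact hm.1
  by_cases haj : a = j
  · rw [haj]; exact hm.2
  exact hk a hai haj

theorem PiA_correct (d : ℕ) (hd : 2 ≤ d) :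
    (PiA d hd).Deterministic ∧ (PiA d hd).Computes1Aware (threshold d) ∧
    Fintype.card (Fin d ⊕ Unit) = d + 1 := by
  refine ⟨?_, ?_, by simp⟩
  · intro q1 q2
    change ∃ p, ADelta d q1 q2 = {p}
    rcases q1 with x | u
    · rcases q2 with y | u
      · simp only [ADelta]
        split_ifs
        · exact ⟨_, rfl⟩
        · exact ⟨_, rfl⟩
      · exact ⟨_, ADelta_top_right d _ u⟩
    · exact ⟨_, ADelta_top_left d _ u⟩
  · intro n _
    refine ⟨fun hR C hC i => ?_, fun hR E hE hF => ?_⟩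
    · simp only [threshold, decide_eq_false_iff_not] at hR
      rcases AInv_reach d hd _ _ (AInv_init d hd n) hC with h | h
      · exact absurd h.1 hR
      · obtain ⟨x, hx⟩ := h.1 i
        exact ⟨x, hx.symm⟩
    · simp only [threshold, decide_eq_true_eq] at hR
      have hinv : ∀ k, AInv d n (E k) := by
        intro k
        induction k with
        | zero => rw [hE.1]; exact AInv_init d hd n
        | succ k ih => exact AInv_step d hd _ _ ih (hE.2 k)
      obtain ⟨C, hC⟩ := Finite.exists_infinite_fiber E
      have hinf : (E ⁻¹' {C}).Infinite := Set.infinite_coe_iff.mp hC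
      have hio : ∀ N : ℕ, ∃ i ≥ N, E i = C := by
        intro N
        obtain ⟨i, hi, hlt⟩ := hinf.exists_gt N
        exact ⟨i, hlt.le, hi⟩
      have hCinv : AInv d n C := by
        obtain ⟨i, _, hi⟩ := hio 0
        exact hi ▸ hinv i
      obtain ⟨i0, _, hi0⟩ := hF C _ hio (reach_top d hd hR _ C rfl hCinv) 0
      refine ⟨i0, fun i hi a => ?_⟩
      have : E i = fun _ => .inr () := by
        induction i, hi using Nat.le_induction with
        | base => exact hi0
        | succ k _ ih =>
          have := hE.2 k
          rw [ih] at this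
          exact top_absorb d hd _ this
      rw [this]
      rfl
end

section
/- For every integer m ≥ 1 and d = 2^m, the protocol Π^P_m defined in the context is a deterministic 1-aware population protocol computing the threshold predicate R_d, and it has exactly m + 2 states. -/
/-- The transition function of the protocol `Π^P_m` (for the threshold `d = 2^m`).
A state `Sum.inl i` means the agent holds `2^i` coins (`c_i`); `Sum.inr false`
is the bankrupt state `B`; `Sum.inr true` is the converted state `⊤`. -/
def PDelta (m : ℕ) :
    (Fin m ⊕ Bool) → (Fin m ⊕ Bool) → Set ((Fin m ⊕ Bool) × (Fin m ⊕ Bool))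
  | .inr true, _ => {(.inr true, .inr true)}
  | _, .inr true => {(.inr true, .inr true)}
  | .inl i, .inl j =>
      if i = j then
        if h : i.val = m - 1 then {(.inr true, .inr true)}
        else {(.inl ⟨i.val + 1, by have := i.isLt; omega⟩, .inr false)}
      else {(.inl i, .inl j)}
  | q, q' => {(q, q')}

/-- The protocol `Π^P_m` computing the threshold predicate for `d = 2^m`. -/
def PiP (m : ℕ) (hm : 1 ≤ m) : PopulationProtocol (Fin m ⊕ Bool) where
  Q0 := {q | q ≠ .inr true}
  Q1 := {.inr true}
  qinit := .inl ⟨0, by omega⟩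
  delta := PDelta m
  union_eq := by
    ext q; simp; tauto
  inter_eq := by
    ext q; simp
  delta_nonempty := by
    intro q1 q2
    rcases q1 with i | (_ | _) <;> rcases q2 with j | (_ | _) <;>
      simp only [PDelta] <;>
      first
      | (split_ifs <;> exact Set.singleton_nonempty _)
      | exact Set.singleton_nonempty _

/-- coin weight -/
def pw (m : ℕ) : (Fin m ⊕ Bool) → ℕ
  | .inl i => 2 ^ i.val
  | .inr _ => 0

/-- progress measure -/
def pg (m : ℕ) : (Fin m ⊕ Bool) → ℕ
  | .inl _ => 2
  | .inr false => 1
  | .inr true => 0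

theorem PDelta_spec (m : ℕ) (x y p q : Fin m ⊕ Bool) (h : (p, q) ∈ PDelta m x y) :
    ((x = .inr true ∨ y = .inr true) ∧ p = .inr true ∧ q = .inr true) ∨
    (∃ i : Fin m, x = .inl i ∧ y = .inl i ∧ i.val = m - 1 ∧ p = .inr true ∧ q = .inr true) ∨
    (∃ i i' : Fin m, x = .inl i ∧ y = .inl i ∧ i'.val = i.val + 1 ∧ p = .inl i' ∧
      q = .inr false) ∨
    (p = x ∧ q = y) := by
  rcases x with i | (_ | _) <;> rcases y with j | (_ | _) <;>
    simp only [PDelta] at h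
  case inl.inl =>
    split_ifs at h with h1 h2
    · simp at h; subst h1; right; left; exact ⟨i, rfl, rfl, h2, h⟩
    · simp at h; subst h1; right; right; left
      exact ⟨i, ⟨i.val + 1, by have := i.isLt; omega⟩, rfl, rfl, rfl, h⟩
    · simp at h; right; right; right; exact h
  all_goals simp at h; simp [h]

theorem sum_two {n : ℕ} {Q : Type} (g : Q → ℕ) (C D : Fin n → Q) (i j : Fin n) (hij : i ≠ j)
    (h : ∀ k, k ≠ i → k ≠ j → D k = C k) :
    ∑ k, g (D k) + g (C i) + g (C j) = ∑ k, g (C k) + g (D i) + g (D j) := by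
  have key : ∀ F : Fin n → Q, ∑ k, g (F k) =
      g (F i) + (g (F j) + ∑ k ∈ (Finset.univ.erase i).erase j, g (F k)) := by
    intro F
    rw [← Finset.add_sum_erase Finset.univ _ (Finset.mem_univ i),
      ← Finset.add_sum_erase (Finset.univ.erase i) _ (by simp [hij.symm] : j ∈ Finset.univ.erase i)]
  have e : ∑ k ∈ (Finset.univ.erase i).erase j, g (D k) =
      ∑ k ∈ (Finset.univ.erase i).erase j, g (C k) := by
    apply Finset.sum_congr rfl
    intro k hk
    simp at hk
    rw [h k hk.2 hk.1]
  rw [key C, key D, e]; ring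

theorem top_step {m n : ℕ} (hm : 1 ≤ m) {C D : Fin n → Fin m ⊕ Bool}
    (h : (PiP m hm).Transition C D) (a : Fin n) (ha : C a = .inr true) : D a = .inr true := by
  obtain ⟨i, j, hij, hd, hk⟩ := h
  by_cases hi : a = i
  · subst hi
    rcases PDelta_spec m _ _ _ _ hd with h | ⟨_, h, _⟩ | ⟨_, _, h, _⟩ | h
    · exact h.2.1
    · simp [ha] at h
    · simp [ha] at h
    · rw [h.1, ha]
  by_cases hj : a = j
  · subst hj
    rcases PDelta_spec m _ _ _ _ hd with h | ⟨_, _, h, _⟩ | ⟨_, _, _, h, _⟩ | h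
    · exact h.2.2
    · simp [ha] at h
    · simp [ha] at h
    · rw [h.2, ha]
  rw [hk a hi hj, ha]

theorem inv_step {m n : ℕ} (hm : 1 ≤ m) {C D : Fin n → Fin m ⊕ Bool}
    (h : (PiP m hm).Transition C D) (hC : ∀ a, C a ≠ .inr true)
    (hs : ∑ a, pw m (C a) = n) :
    ((∀ a, D a ≠ .inr true) ∧ ∑ a, pw m (D a) = n) ∨
    ((∃ a, D a = .inr true) ∧ 2 ^ m ≤ n) := by
  obtain ⟨i, j, hij, hd, hk⟩ := h
  have hsum := sum_two (pw m) C D i j hij hk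
  have hne : D i ≠ .inr true → D j ≠ .inr true → ∀ a, D a ≠ .inr true := by
    intro h1 h2 a
    by_cases hi : a = i
    · rw [hi]; exact h1
    by_cases hj : a = j
    · rw [hj]; exact h2
    rw [hk a hi hj]; exact hC a
  rcases PDelta_spec m _ _ _ _ hd with h | ⟨l, h1, h2, h3, h4, h5⟩ |
    ⟨l, l', h1, h2, h3, h4, h5⟩ | ⟨h1, h2⟩
  · rcases h.1 with h | h <;> exact absurd h (hC _)
  · right
    refine ⟨⟨i, h4⟩, ?_⟩
    rw [h1, h2, h4, h5] at hsum
    simp only [pw, h3] at hsum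
    have : ∑ a, pw m (C a) ≥ pw m (C i) + pw m (C j) := by
      rw [← Finset.sum_pair (f := fun a => pw m (C a)) hij]
      exact Finset.sum_le_sum_of_subset (Finset.subset_univ _)
    rw [hs, h1, h2] at this
    simp only [pw, h3] at this
    obtain ⟨k, rfl⟩ : ∃ k, m = k + 1 := ⟨m - 1, by omega⟩
    simp only [Nat.add_sub_cancel] at this
    rw [pow_succ]; omega
  · left
    refine ⟨hne (by simp [h4]) (by simp [h5]), ?_⟩
    rw [h1, h2, h4, h5] at hsum
    have e1 : pw m (.inl l) = 2 ^ l.val := rfl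
    have e2 : pw m (.inl l') = 2 ^ l.val * 2 := by rw [← pow_succ, ← h3]; rfl
    have e3 : pw m (.inr false) = 0 := rfl
    rw [e1, e2, e3] at hsum
    omega
  · left
    refine ⟨hne (by rw [h1]; exact hC _) (by rw [h2]; exact hC _), ?_⟩
    rw [h1, h2] at hsum
    omega

theorem init_inv {m n : ℕ} (hm : 1 ≤ m) :
    (∀ a, (PiP m hm).initConfig n a ≠ .inr true) ∧
      ∑ a, pw m ((PiP m hm).initConfig n a) = n := by
  simp [PopulationProtocol.initConfig, PiP, pw]

/-- the invariant used for large populations -/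
def PInv (m n : ℕ) (C : Fin n → Fin m ⊕ Bool) : Prop :=
  (∃ a, C a = .inr true) ∨ ((∀ a, C a ≠ .inr true) ∧ ∑ a, pw m (C a) = n)

theorem PInv_step {m n : ℕ} (hm : 1 ≤ m) {C D : Fin n → Fin m ⊕ Bool}
    (h : (PiP m hm).Transition C D) (hC : PInv m n C) : PInv m n D := by
  rcases hC with ⟨a, ha⟩ | ⟨h1, h2⟩
  · exact Or.inl ⟨a, top_step hm h a ha⟩
  · rcases inv_step hm h h1 h2 with h | h
    · exact Or.inr h
    · exact Or.inl h.1

theorem exists_pair {m n : ℕ} (hn : 2 ^ m ≤ n) (C : Fin n → Fin m ⊕ Bool)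
    (hs : ∑ a, pw m (C a) = n) :
    ∃ i j : Fin n, i ≠ j ∧ ∃ l : Fin m, C i = .inl l ∧ C j = .inl l := by
  by_contra hcon
  push Not at hcon
  have h1 : ∀ x : Fin m ⊕ Bool, pw m x = ∑ l : Fin m, if x = .inl l then 2 ^ l.val else 0 := by
    intro x
    rcases x with i | b
    · simp [pw]
    · simp [pw]
  have h2 : ∑ a, pw m (C a) = ∑ l : Fin m, ∑ a, if C a = .inl l then 2 ^ l.val else 0 := by
    rw [Finset.sum_comm]
    exact Finset.sum_congr rfl fun a _ => h1 _
  have h3 : ∑ l : Fin m, ∑ a, (if C a = .inl l then 2 ^ l.val else 0) ≤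
      ∑ l : Fin m, 2 ^ l.val := by
    apply Finset.sum_le_sum
    intro l _
    rw [← Finset.sum_filter, Finset.sum_const, smul_eq_mul]
    have : (Finset.univ.filter fun a => C a = .inl l).card ≤ 1 := by
      rw [Finset.card_le_one]
      intro a ha b hb
      simp at ha hb
      by_contra hab
      exact hcon a b hab l ha hb
    nlinarith [Nat.zero_le (2 ^ l.val)]
  have h4 : ∑ l : Fin m, 2 ^ l.val < 2 ^ m := by
    rw [Fin.sum_univ_eq_sum_range (fun i => 2 ^ i) m, Nat.geomSum_eq (le_refl 2)]
    have := Nat.one_le_two_pow (n := m)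
    simp; 
  omega

theorem progress_s19 {m n : ℕ} (hm : 1 ≤ m) (hn : 2 ^ m ≤ n) (C : Fin n → Fin m ⊕ Bool)
    (hC : PInv m n C) (hne : ∃ a, C a ≠ .inr true) :
    ∃ D, (PiP m hm).Transition C D ∧ ∑ a, pg m (D a) < ∑ a, pg m (C a) := by
  have mk : ∀ i j : Fin n, i ≠ j → ∀ p q, (p, q) ∈ PDelta m (C i) (C j) →
      pg m p + pg m q < pg m (C i) + pg m (C j) →
      ∃ D, (PiP m hm).Transition C D ∧ ∑ a, pg m (D a) < ∑ a, pg m (C a) := by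
    intro i j hij p q hpq hlt
    let D := Function.update (Function.update C i p) j q
    have hi : D i = p := by simp [D, hij]
    have hj : D j = q := by simp [D]
    have hk : ∀ k, k ≠ i → k ≠ j → D k = C k := by
      intro k h1 h2; simp [D, h1, h2]
    refine ⟨D, ⟨i, j, hij, ?_, hk⟩, ?_⟩
    · rw [hi, hj]; exact hpq
    · have := sum_two (pg m) C D i j hij hk
      rw [hi, hj] at this
      omega
  rcases hC with ⟨a, ha⟩ | ⟨_, h2⟩
  · obtain ⟨b, hb⟩ := hne
    refine mk a b (by rintro rfl; exact hb ha) (.inr true) (.inr true) ?_ ?_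
    · rw [ha]; simp [PDelta]
    · rw [ha]
      generalize C b = x at hb
      rcases x with i | (_ | _) <;> simp_all [pg]
  · obtain ⟨i, j, hij, l, hi, hj⟩ := exists_pair hn C h2
    by_cases hl : l.val = m - 1
    · refine mk i j hij (.inr true) (.inr true) ?_ ?_
      · rw [hi, hj]; simp [PDelta, hl]
      · rw [hi, hj]; simp [pg]
    · refine mk i j hij (.inl ⟨l.val + 1, by have := l.isLt; omega⟩) (.inr false) ?_ ?_
      · rw [hi, hj]; simp [PDelta, hl]
      · rw [hi, hj]; simp [pg]

theorem reach_top_s19 {m n : ℕ} (hm : 1 ≤ m) (hn : 2 ^ m ≤ n) (k : ℕ) :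
    ∀ C : Fin n → Fin m ⊕ Bool, PInv m n C → ∑ a, pg m (C a) ≤ k →
      (PiP m hm).Reachable C (fun _ => .inr true) := by
  induction k with
  | zero =>
    intro C hC hk
    by_cases hne : ∃ a, C a ≠ .inr true
    · obtain ⟨D, _, h⟩ := progress_s19 hm hn C hC hne
      omega
    · push Not at hne
      rw [show C = fun _ => .inr true from funext hne]
      exact Relation.ReflTransGen.refl
  | succ k ih =>
    intro C hC hk
    by_cases hne : ∃ a, C a ≠ .inr true
    · obtain ⟨D, hD, h⟩ := progress_s19 hm hn C hC hne
      exact Relation.ReflTransGen.head hD (ih D (PInv_step hm hD hC) (by omega))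
    · push Not at hne
      rw [show C = fun _ => .inr true from funext hne]
      exact Relation.ReflTransGen.refl

theorem PiP_correct (m : ℕ) (hm : 1 ≤ m) :
    (PiP m hm).Deterministic ∧ (PiP m hm).Computes1Aware (threshold (2 ^ m)) ∧
    Fintype.card (Fin m ⊕ Bool) = m + 2 := by
  refine ⟨?_, ?_, by simp⟩
  · intro q1 q2
    change ∃ p, PDelta m q1 q2 = {p}
    rcases q1 with i | (_ | _) <;> rcases q2 with j | (_ | _) <;>
      simp only [PDelta] <;>
      first
      | exact ⟨_, rfl⟩
      | (split_ifs <;> exact ⟨_, rfl⟩)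
  · intro n hn
    constructor
    · intro hR C hC
      have hlt : ¬ 2 ^ m ≤ n := by simpa [threshold] using hR
      have : (∀ a, C a ≠ .inr true) ∧ ∑ a, pw m (C a) = n := by
        induction hC with
        | refl => exact init_inv hm
        | tail _ h ih =>
          rcases inv_step hm h ih.1 ih.2 with h | h
          · exact h
          · exact absurd h.2 hlt
      exact this.1
    · intro hR E hE hF
      have hle : 2 ^ m ≤ n := by simpa [threshold] using hR
      have hinv : ∀ i, PInv m n (E i) := by
        intro i
        induction i with
        | zero => rw [hE.1]; exact Or.inr (init_inv hm)
        | succ i ih => exact PInv_step hm (hE.2 i) ih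
      obtain ⟨C, hC⟩ := Finite.exists_infinite_fiber E
      have hC' : (E ⁻¹' {C}).Infinite := Set.infinite_coe_iff.mp hC
      have hio : ∀ N : ℕ, ∃ i ≥ N, E i = C := by
        intro N
        obtain ⟨i, hi, hN⟩ := hC'.exists_gt N
        exact ⟨i, hN.le, hi⟩
      obtain ⟨i1, _, h1⟩ := hio 0
      obtain ⟨i0, _, h0⟩ := hF C _ hio
        (reach_top_s19 hm hle _ C (h1 ▸ hinv i1) le_rfl) 0
      refine ⟨i0, ?_⟩
      intro i hi a
      change E i a = .inr true
      induction i, hi using Nat.le_induction with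
      | base => rw [h0]
      | succ i _ ih => exact top_step hm (hE.2 i) a ih
end
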